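/- Let p ≡ 1 (mod 4) be a prime and let a be a nonzero element of F_p. Then ∑_{x ∈ F_p} ψ(a·x²) = χ(a)·√p. -/

import Mathlib

open scoped Classical
open Finset

noncomputable section

/-- The quadratic character `χ` of `F_p`: `χ 0 = 0`, `χ x = 1` if `x` is a nonzero square,
and `χ x = -1` otherwise. -/
def quadChar (p : ℕ) (x : ZMod p) : ℤ :=
  if x = 0 then 0 else if IsSquare x then 1 else -1

/-- The canonical additive character `ψ` of `F_p`, `ψ x = exp(2πi·x/p)`. -/
def addChar' (p : ℕ) (x : ZMod p) : ℂ :=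
  Complex.exp (2 * Real.pi * Complex.I * (x.val : ℂ) / (p : ℂ))

/-- The set of quadratic residues mod `p` (nonzero squares), as a type. -/
abbrev QRes (p : ℕ) : Type := {b : ZMod p // b ≠ 0 ∧ IsSquare b}

/-- The Paley ETF: rows indexed by `{0} ∪ Q_p` (with `none` the `0`-row),
columns indexed by `F_p ∪ {∞}` (with `none` the `∞`-column). -/
def PaleyETF (p : ℕ) : Matrix (Option (QRes p)) (Option (ZMod p)) ℂ :=
  fun r c =>
    match r, c with
    | none, none => 1
    | none, some _ => ((1 / Real.sqrt p : ℝ) : ℂ)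
    | some _, none => 0
    | some b, some a => ((Real.sqrt (2 / p) : ℝ) : ℂ) * addChar' p (b.1 * a)

/-- `(K, δ)`-restricted isometry property for a complex matrix: for every vector `x`
with at most `K` nonzero entries, `(1-δ)‖x‖² ≤ ‖Φx‖² ≤ (1+δ)‖x‖²`. -/
def HasRIP {M N : Type*} [Fintype M] [Fintype N] (Φ : Matrix M N ℂ) (K δ : ℝ) : Prop :=
  ∀ x : N → ℂ, ((Finset.univ.filter fun n => x n ≠ 0).card : ℝ) ≤ K →
    (1 - δ) * ∑ n, ‖x n‖ ^ 2 ≤ ∑ m, ‖∑ n, Φ m n * x n‖ ^ 2 ∧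
      ∑ m, ‖∑ n, Φ m n * x n‖ ^ 2 ≤ (1 + δ) * ∑ n, ‖x n‖ ^ 2

/-- The Paley graph extractor: `Ext_p(x,y) = 1` if `x = y`, and `(χ(x−y)+1)/2` otherwise
(which is `1` iff `x − y` is a nonzero square, `0` otherwise). -/
def paleyExt (p : ℕ) (x y : ZMod p) : ℕ :=
  if x = y then 1 else if IsSquare (x - y) then 1 else 0

/-- Indicator vector of `U ⊆ F_p` with respect to the column indexing of the Paley ETF
(entry `0` in the `∞` coordinate). -/
def indic (p : ℕ) (U : Finset (ZMod p)) : Option (ZMod p) → ℂ :=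
  fun c => match c with
  | none => 0
  | some a => if a ∈ U then 1 else 0

/-- A lower bound by summation by parts for an antitone nonnegative weight `c`. -/
lemma neg_mul_le_sum_mul_sub {n : ℕ} {c t : ℕ → ℝ} (ht : ∀ i, 0 ≤ t i)
    (hc : ∀ i < n, 0 ≤ c i) (hanti : ∀ i, i + 1 < n → c (i + 1) ≤ c i) (hn : 0 < n) :
    -(c 0 * t 0) ≤ ∑ i ∈ range n, c i * (t (i + 1) - t i) := by
  have key : ∀ k < n, c k * t (k + 1) - c 0 * t 0 ≤
      ∑ i ∈ range (k + 1), c i * (t (i + 1) - t i) := by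
    intro k
    induction k with
    | zero => intro _; simp; linarith
    | succ k ih =>
      intro hk
      rw [sum_range_succ]
      have h₁ := ih (by omega)
      have h₂ := mul_le_mul_of_nonneg_right (hanti k hk) (ht (k + 1))
      linarith
  obtain ⟨k, rfl⟩ : ∃ k, n = k + 1 := ⟨n - 1, by omega⟩
  have h₁ := key k (by omega)
  have h₂ := mul_nonneg (hc k (by omega)) (ht (k + 1))
  linarith

/-- Folding a sum over a period of an even function of odd period `4 * N + 1`. -/
lemma sum_range_four_mul_add_one (N : ℕ) (f : ℕ → ℝ)
    (hf : ∀ r ≤ 4 * N + 1, f (4 * N + 1 - r) = f r) :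
    ∑ r ∈ range (4 * N + 1), f r =
      f 0 + 2 * ∑ i ∈ range N, f (i + 1) + 2 * ∑ i ∈ range N, f (2 * N - i) := by
  have h₁ : ∑ i ∈ range (2 * N), f (2 * N + i + 1) = ∑ i ∈ range (2 * N), f (i + 1) := by
    rw [← sum_range_reflect]
    refine sum_congr rfl fun i hi => ?_
    rw [mem_range] at hi
    rw [← hf (i + 1) (by omega)]
    congr 1
    omega
  have h₂ : ∑ i ∈ range N, f (N + i + 1) = ∑ i ∈ range N, f (2 * N - i) := by
    rw [← sum_range_reflect]
    refine sum_congr rfl fun i hi => ?_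
    rw [mem_range] at hi
    congr 1
    omega
  rw [sum_range_succ', show 4 * N = 2 * N + 2 * N by ring, sum_range_add, h₁, two_mul N,
    sum_range_add, h₂, two_mul N]
  ring

/-- Jordan's inequality, in the form used for the frequencies `2πu/p`. -/
lemma four_mul_div_le_sin {p u : ℝ} (hp : 0 < p) (hu : 0 ≤ u) (hup : 4 * u ≤ p) :
    4 * u / p ≤ Real.sin (2 * Real.pi * u / p) := by
  have hpi := Real.pi_pos
  have h := Real.mul_le_sin (x := 2 * Real.pi * u / p) (by positivity)
    (by rw [div_le_iff₀ hp]; nlinarith)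
  refine le_trans (le_of_eq ?_) h
  field_simp
  ring

lemma sin_le_sin_of_four_mul_le {p u v : ℝ} (hp : 0 < p) (hu : 0 ≤ u) (huv : u ≤ v)
    (hvp : 4 * v ≤ p) :
    Real.sin (2 * Real.pi * u / p) ≤ Real.sin (2 * Real.pi * v / p) := by
  have hpi := Real.pi_pos
  have hu' : 0 ≤ 2 * Real.pi * u / p := by positivity
  apply Real.sin_le_sin_of_le_of_le_pi_div_two (by linarith)
  · rw [div_le_iff₀ hp]; nlinarith
  · gcongr

/-- A tail of the quadratic cosine sum, starting from `m + 1`. -/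
lemma neg_div_le_sum_cos_sq {p : ℝ} (hp : 0 < p) (m n : ℕ) (h : 4 * ((m : ℝ) + n) ≤ p) :
    -(p / (4 * (m + 1))) ≤
      ∑ i ∈ range n, Real.cos (2 * Real.pi * ((m : ℝ) + i + 1) ^ 2 / p) := by
  rcases n.eq_zero_or_pos with rfl | hn
  · simp only [range_zero, sum_empty, neg_nonpos]
    positivity
  have hle : ∀ i < n, 4 * ((m : ℝ) + i + 1) ≤ p := fun i hi => by
    have : (i : ℝ) + 1 ≤ n := by exact_mod_cast hi
    linarith
  have hpos : ∀ i < n, 0 < Real.sin (2 * Real.pi * ((m : ℝ) + i + 1) / p) := fun i hi =>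
    lt_of_lt_of_le (by positivity) (four_mul_div_le_sin hp (by positivity) (hle i hi))
  set c : ℕ → ℝ := fun i => (2 * Real.sin (2 * Real.pi * ((m : ℝ) + i + 1) / p))⁻¹ with hc
  set t : ℕ → ℝ := fun i =>
    Real.sin (2 * Real.pi * (((m : ℝ) + i) * (m + i + 1)) / p) + 1 with ht
  have ht_nonneg : ∀ i, 0 ≤ t i := fun i => by
    linarith [Real.neg_one_le_sin (2 * Real.pi * (((m : ℝ) + i) * (m + i + 1)) / p)]
  have habel := neg_mul_le_sum_mul_sub (n := n) (c := c) (t := t) ht_nonneg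
    (fun i hi => inv_nonneg.2 (by linarith [hpos i hi]))
    (fun i hi => by
      refine inv_anti₀ (by linarith [hpos i (by omega)]) ?_
      have := sin_le_sin_of_four_mul_le (u := m + i + 1) (v := m + (i + 1 : ℕ) + 1) hp
        (by positivity) (by push_cast; linarith) (hle _ hi)
      linarith) hn
  have hsum : ∑ i ∈ range n, c i * (t (i + 1) - t i) =
      ∑ i ∈ range n, Real.cos (2 * Real.pi * ((m : ℝ) + i + 1) ^ 2 / p) := by
    refine sum_congr rfl fun i hi => ?_
    have h₀ := hpos i (mem_range.1 hi)
    simp only [hc, ht]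
    rw [show 2 * Real.pi * (((m : ℝ) + (i + 1 : ℕ)) * (m + (i + 1 : ℕ) + 1)) / p =
        2 * Real.pi * ((m : ℝ) + i + 1) ^ 2 / p + 2 * Real.pi * ((m : ℝ) + i + 1) / p by
          push_cast; ring,
      show 2 * Real.pi * (((m : ℝ) + i) * (m + i + 1)) / p =
        2 * Real.pi * ((m : ℝ) + i + 1) ^ 2 / p - 2 * Real.pi * ((m : ℝ) + i + 1) / p by ring,
      Real.sin_add, Real.sin_sub]
    field_simp
    ring
  rw [hsum] at habel
  refine le_trans (neg_le_neg ?_) habel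
  have hj := four_mul_div_le_sin hp (by positivity) (hle 0 hn)
  have ht0 : t 0 ≤ 2 := by
    have := Real.sin_le_one (2 * Real.pi * (((m : ℝ) + (0 : ℕ)) * (m + (0 : ℕ) + 1)) / p)
    simp only [ht]
    linarith
  have hc0 : c 0 ≤ (2 * (4 * ((m : ℝ) + (0 : ℕ) + 1) / p))⁻¹ :=
    inv_anti₀ (by positivity) (by linarith)
  calc c 0 * t 0 ≤ (2 * (4 * ((m : ℝ) + (0 : ℕ) + 1) / p))⁻¹ * 2 := by
        exact mul_le_mul hc0 ht0 (ht_nonneg 0) (by positivity)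
    _ = p / (4 * (m + 1)) := by push_cast; field_simp; ring

/-- The quadratic sine sum over half-integers is almost nonnegative. -/
lemma neg_half_le_sum_sin_sq {p : ℝ} (hp : 0 < p) (n : ℕ) (h : 4 * (n : ℝ) ≤ p) :
    -(1 / 2) ≤ ∑ i ∈ range n, Real.sin (2 * Real.pi * ((i : ℝ) + 1 / 2) ^ 2 / p) := by
  rcases n.eq_zero_or_pos with rfl | hn
  · norm_num
  have hle : ∀ i < n, 4 * ((i : ℝ) + 1 / 2) ≤ p := fun i hi => by
    have : (i : ℝ) + 1 ≤ n := by exact_mod_cast hi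
    linarith
  have hpos : ∀ i < n, 0 < Real.sin (2 * Real.pi * ((i : ℝ) + 1 / 2) / p) := fun i hi =>
    lt_of_lt_of_le (by positivity) (four_mul_div_le_sin hp (by positivity) (hle i hi))
  set c : ℕ → ℝ := fun i => (2 * Real.sin (2 * Real.pi * ((i : ℝ) + 1 / 2) / p))⁻¹ with hc
  set t : ℕ → ℝ := fun i => 1 - Real.cos (2 * Real.pi * ((i : ℝ) ^ 2 - 1 / 4) / p) with ht
  have habel := neg_mul_le_sum_mul_sub (n := n) (c := c) (t := t)
    (fun i => sub_nonneg.2 (Real.cos_le_one _))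
    (fun i hi => inv_nonneg.2 (by linarith [hpos i hi]))
    (fun i hi => by
      refine inv_anti₀ (by linarith [hpos i (by omega)]) ?_
      have := sin_le_sin_of_four_mul_le (u := i + 1 / 2) (v := (i + 1 : ℕ) + 1 / 2) hp
        (by positivity) (by push_cast; linarith) (hle _ hi)
      linarith) hn
  have hsum : ∑ i ∈ range n, c i * (t (i + 1) - t i) =
      ∑ i ∈ range n, Real.sin (2 * Real.pi * ((i : ℝ) + 1 / 2) ^ 2 / p) := by
    refine sum_congr rfl fun i hi => ?_
    have h₀ := hpos i (mem_range.1 hi)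
    simp only [hc, ht]
    rw [show 2 * Real.pi * (((i + 1 : ℕ) : ℝ) ^ 2 - 1 / 4) / p =
        2 * Real.pi * ((i : ℝ) + 1 / 2) ^ 2 / p + 2 * Real.pi * ((i : ℝ) + 1 / 2) / p by
          push_cast; ring,
      show 2 * Real.pi * ((i : ℝ) ^ 2 - 1 / 4) / p =
        2 * Real.pi * ((i : ℝ) + 1 / 2) ^ 2 / p - 2 * Real.pi * ((i : ℝ) + 1 / 2) / p by ring,
      Real.cos_add, Real.cos_sub]
    rw [inv_mul_eq_div, div_eq_iff (by positivity)]
    ring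
  rw [hsum] at habel
  refine le_trans (neg_le_neg ?_) habel
  have hp4 : 4 ≤ p := by
    have : (1 : ℝ) ≤ n := by exact_mod_cast hn
    linarith
  have hpi := Real.pi_pos
  have hpi4 := Real.pi_le_four
  set x : ℝ := Real.pi / (2 * p) with hx
  have hx0 : 0 < x := by positivity
  have hx1 : x ≤ 1 / 2 := by rw [hx, div_le_iff₀ (by positivity)]; linarith
  have hsin : 0 < Real.sin x := Real.sin_pos_of_pos_of_lt_pi hx0 (by linarith [Real.pi_gt_three])
  have hcos : 1 / 2 ≤ Real.cos x := by nlinarith [Real.one_sub_sq_div_two_le_cos (x := x)]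
  have hc0 : c 0 = (2 * Real.sin (2 * x))⁻¹ := by
    simp only [hc, hx]
    congr 3
    push_cast
    field_simp
    ring
  have ht0 : t 0 = 1 - Real.cos x := by
    simp only [ht, hx]
    rw [← Real.cos_neg]
    congr 2
    push_cast
    field_simp
    ring
  have hsin1 := Real.sin_le_one x
  have hcos1 := Real.cos_le_one x
  have hsq := Real.sin_sq_add_cos_sq x
  rw [hc0, ht0, Real.sin_two_mul, inv_mul_eq_div, div_le_iff₀ (by positivity)]
  nlinarith

lemma neg_sqrt_lt_sum_cos_sq (N : ℕ) (p : ℝ) (hp : p = 4 * N + 1) :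
    -√p < ∑ r ∈ range (4 * N + 1), Real.cos (2 * Real.pi * (r : ℝ) ^ 2 / p) := by
  have hp0 : 0 < p := by rw [hp]; positivity
  have hpi := Real.pi_pos
  rw [sum_range_four_mul_add_one]
  swap
  · intro r hr
    rw [← Real.cos_add_int_mul_two_pi (2 * Real.pi * (r : ℝ) ^ 2 / p) (4 * N + 1 - 2 * r)]
    congr 1
    push_cast [hr]
    rw [← hp]
    field_simp
    ring
  have hhalf : ∑ i ∈ range N, Real.cos (2 * Real.pi * ((2 * N - i : ℕ) : ℝ) ^ 2 / p) =
      ∑ i ∈ range N, Real.sin (2 * Real.pi * ((i : ℝ) + 1 / 2) ^ 2 / p) := by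
    refine sum_congr rfl fun i hi => ?_
    have hi' := mem_range.1 hi
    rw [← Real.cos_sub_pi_div_two, ← Real.cos_add_int_mul_two_pi _ (i - N)]
    congr 1
    push_cast [show i ≤ 2 * N by omega]
    rw [show (N : ℝ) = (p - 1) / 4 by linarith]
    field_simp
    ring
  have hsin := neg_half_le_sum_sin_sq hp0 N (by linarith)
  have hs0 : 0 < √p := Real.sqrt_pos.2 hp0
  have hsq : √p * √p = p := Real.mul_self_sqrt hp0.le
  have hnonneg : ∀ k : ℕ, (2 * k : ℝ) ≤ √p →
      0 ≤ ∑ i ∈ range k, Real.cos (2 * Real.pi * ((i + 1 : ℕ) : ℝ) ^ 2 / p) := by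
    intro k hk
    refine sum_nonneg fun i hi => ?_
    have hi' : ((i + 1 : ℕ) : ℝ) ≤ k := by exact_mod_cast mem_range.1 hi
    have hi0 : (0 : ℝ) ≤ ((i + 1 : ℕ) : ℝ) := by positivity
    have h4 : 4 * ((i + 1 : ℕ) : ℝ) ^ 2 ≤ p := by nlinarith
    have hx0 : 0 ≤ 2 * Real.pi * ((i + 1 : ℕ) : ℝ) ^ 2 / p := by positivity
    refine Real.cos_nonneg_of_neg_pi_div_two_le_of_le (by linarith) ?_
    rw [div_le_iff₀ hp0]
    nlinarith
  have hcos : -(√p / 2) < ∑ i ∈ range N, Real.cos (2 * Real.pi * ((i + 1 : ℕ) : ℝ) ^ 2 / p) := by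
    obtain ⟨m, hm, hm'⟩ : ∃ m : ℕ, (2 * m : ℝ) ≤ √p ∧ √p < 2 * (m + 1) :=
      ⟨⌊√p / 2⌋₊, by linarith [Nat.floor_le (show 0 ≤ √p / 2 by positivity)],
        by linarith [Nat.lt_floor_add_one (√p / 2)]⟩
    rcases le_total N m with hNm | hNm
    · have hNm' : (N : ℝ) ≤ m := by exact_mod_cast hNm
      linarith [hnonneg N (by linarith)]
    · obtain ⟨n, rfl⟩ := Nat.exists_eq_add_of_le hNm
      rw [sum_range_add]
      have h₁ := hnonneg m hm
      have h₂ := neg_div_le_sum_cos_sq hp0 m n (by push_cast at hp; linarith)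
      have h₃ : p / (4 * ((m : ℝ) + 1)) < √p / 2 := by
        rw [div_lt_iff₀ (by positivity)]
        nlinarith
      push_cast at h₁ ⊢
      linarith
  rw [hhalf]
  have h₀ : Real.cos (2 * Real.pi * ((0 : ℕ) : ℝ) ^ 2 / p) = 1 := by simp
  linarith

lemma sum_addChar_mul_sq {F : Type*} [Field F] [Fintype F] [DecidableEq F]
    (hF : ringChar F ≠ 2) {ψ : AddChar F ℂ} (hψ : ψ.IsPrimitive) {a : F} (ha : a ≠ 0) :
    ∑ x : F, ψ (a * x ^ 2) =
      quadraticChar F a * gaussSum ((quadraticChar F).ringHomComp (Int.castRingHom ℂ)) ψ := by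
  have hcount : ∑ x : F, ψ (a * x ^ 2) = ∑ y : F, ((quadraticChar F y : ℂ) + 1) * ψ (a * y) := by
    rw [← sum_fiberwise_of_maps_to (g := fun x : F => x ^ 2) (fun _ _ => mem_univ _)]
    refine sum_congr rfl fun y _ => ?_
    have hcard : ((#{x : F | x ^ 2 = y} : ℕ) : ℂ) = (quadraticChar F y : ℂ) + 1 := by
      have := quadraticChar_card_sqrts hF y
      rw [Set.toFinset_ofPred] at this
      exact_mod_cast this
    rw [← hcard, ← nsmul_eq_mul]
    refine sum_eq_card_nsmul fun x hx => ?_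
    rw [(mem_filter.1 hx).2]
  have hshift := gaussSum_mulShift ((quadraticChar F).ringHomComp (Int.castRingHom ℂ)) ψ
    (Units.mk0 a ha)
  have hsq : (quadraticChar F a : ℂ) * quadraticChar F a = 1 := by
    have := quadraticChar_sq_one ha
    rw [sq] at this
    exact_mod_cast this
  have hzero : ∑ y : F, ψ (a * y) = 0 := by
    have := AddChar.sum_eq_zero_of_ne_one (hψ ha)
    simpa [AddChar.mulShift_apply] using this
  rw [hcount, ← hshift]
  simp only [add_mul, one_mul, sum_add_distrib, hzero, add_zero, Units.val_mk0,
    MulChar.ringHomComp_apply, eq_intCast, ← mul_assoc, hsq, gaussSum, AddChar.mulShift_apply]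

lemma quadChar_eq_quadraticChar (p : ℕ) [Fact p.Prime] (a : ZMod p) :
    quadChar p a = quadraticChar (ZMod p) a := by
  rw [quadChar, quadraticChar_apply, quadraticCharFun]
  split_ifs <;> rfl

lemma addChar'_eq_stdAddChar (p : ℕ) [NeZero p] (x : ZMod p) :
    addChar' p x = ZMod.stdAddChar x := by
  have := ZMod.stdAddChar_coe (N := p) x.val
  simpa [addChar'] using this.symm

lemma re_addChar'_natCast (p n : ℕ) [NeZero p] :
    (addChar' p (n : ZMod p)).re = Real.cos (2 * Real.pi * n / p) := by
  have := ZMod.stdAddChar_coe (N := p) n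
  rw [Int.cast_natCast] at this
  rw [addChar'_eq_stdAddChar, this, ← Complex.exp_ofReal_mul_I_re]
  congr 2
  push_cast
  ring

lemma re_sum_addChar'_sq (p : ℕ) [NeZero p] :
    (∑ x : ZMod p, addChar' p (x ^ 2)).re =
      ∑ r ∈ range p, Real.cos (2 * Real.pi * (r : ℝ) ^ 2 / p) := by
  rw [Complex.re_sum]
  refine sum_bij' (fun x _ => x.val) (fun r _ => (r : ZMod p))
    (fun x _ => mem_range.2 x.val_lt) (fun _ _ => mem_univ _)
    (fun x _ => ZMod.natCast_zmod_val x) (fun r hr => ZMod.val_cast_of_lt (mem_range.1 hr))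
    (fun x _ => ?_)
  have := re_addChar'_natCast p (x.val ^ 2)
  simpa using this

/-- **Gauss sum evaluation.** For a prime `p ≡ 1 (mod 4)` and `a ∈ F_p^*`,
`∑_{x ∈ F_p} ψ(a·x²) = χ(a)·√p`. -/
theorem paley_gauss_sum (p : ℕ) [Fact p.Prime] (hp4 : p % 4 = 1)
    (a : ZMod p) (ha : a ≠ 0) :
    ∑ x : ZMod p, addChar' p (a * x ^ 2) = (quadChar p a : ℂ) * (Real.sqrt p : ℝ) := by
  have hF : ringChar (ZMod p) ≠ 2 := by rw [ZMod.ringChar_zmod_n]; omega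
  have hprim := ZMod.isPrimitive_stdAddChar p
  have hchar : (quadraticChar (ZMod p)).ringHomComp (Int.castRingHom ℂ) ≠ 1 :=
    (MulChar.ringHomComp_ne_one_iff (RingHom.injective_int _)).2 (quadraticChar_ne_one hF)
  have hneg : quadraticChar (ZMod p) (-1) = 1 := by
    rw [quadraticChar_one_iff_isSquare (neg_ne_zero.2 one_ne_zero),
      FiniteField.isSquare_neg_one_iff, ZMod.card]
    omega
  have hsq := gaussSum_sq hchar ((quadraticChar_isQuadratic (ZMod p)).comp _) hprim
  rw [MulChar.ringHomComp_apply, hneg, map_one, one_mul, ZMod.card] at hsq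
  have hone := sum_addChar_mul_sq hF hprim one_ne_zero
  rw [map_one, Int.cast_one, one_mul] at hone
  simp only [one_mul, ← addChar'_eq_stdAddChar] at hone
  have hroot : gaussSum ((quadraticChar (ZMod p)).ringHomComp (Int.castRingHom ℂ))
      ZMod.stdAddChar = (√(p : ℝ) : ℝ) := by
    have hp : ((√(p : ℝ) : ℝ) : ℂ) ^ 2 = p := by
      rw [← Complex.ofReal_pow, Real.sq_sqrt p.cast_nonneg, Complex.ofReal_natCast]
    rcases sq_eq_sq_iff_eq_or_eq_neg.1 (hsq.trans hp.symm) with h | h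
    · exact h
    · have hre := re_sum_addChar'_sq p
      obtain ⟨N, hN⟩ : ∃ N, p = 4 * N + 1 := ⟨p / 4, by omega⟩
      have hlt := neg_sqrt_lt_sum_cos_sq N (p : ℝ) (by exact_mod_cast hN)
      rw [← hN, ← hre, hone, h, Complex.neg_re, Complex.ofReal_re] at hlt
      exact absurd hlt (lt_irrefl _)
  simp only [addChar'_eq_stdAddChar]
  rw [sum_addChar_mul_sq hF hprim ha, hroot, quadChar_eq_quadraticChar]
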